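/- arXiv:math/0509341 — 2 statements merged into one kernel-verified Lean document; each statement's English description precedes it below -/
import Mathlib

section
/- Let W be an n×n symmetric matrix whose only off-diagonal nonzero entries are in the last row and column (i.e., W_{ij} = 0 whenever i ≠ j and i, j < n). Let W' be the diagonal matrix with the same diagonal as W. If the eigenvalues of W lie in the closed cone Γ̄_k, then for every 1 ≤ j ≤ k, σ_j(λ(W')) ≥ σ_j(λ(W)) ≥ 0; in particular the eigenvalues of W' (that is, its diagonal entries) also lie in Γ̄_k. -/
open Set Filter

/-- The `j`-th elementary symmetric polynomial of `l : Fin n → ℝ`. -/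
noncomputable def esymm (n j : ℕ) (l : Fin n → ℝ) : ℝ :=
  ∑ s ∈ Finset.powersetCard j (Finset.univ : Finset (Fin n)), ∏ i ∈ s, l i

/-- The Gårding cone `Γ_k = {λ : σ_j(λ) > 0, j = 1, …, k}`. -/
def GammaCone (n k : ℕ) : Set (Fin n → ℝ) :=
  {l | ∀ j : ℕ, 1 ≤ j → j ≤ k → 0 < esymm n j l}

open Polynomial in
lemma aux_splits_derivative {f : ℝ[X]} (hf : f.Splits) : (derivative f).Splits := by
  by_cases h0 : f.natDegree = 0
  · rw [Polynomial.eq_C_of_natDegree_eq_zero h0]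
    simp
  · rw [splits_iff_card_roots] at hf ⊢
    have h1 := Polynomial.card_roots_le_derivative f
    have h2 := Polynomial.card_roots' (derivative f)
    have h3 := Polynomial.natDegree_derivative_lt h0
    omega

open Polynomial in
lemma aux_newton_zero {f : ℝ[X]} (hf : f.Splits) :
    2 * (f.coeff 0 * f.coeff 2) ≤ f.coeff 1 ^ 2 := by
  obtain ⟨m, hm⟩ := splits_iff_exists_multiset.mp hf
  have key : ∀ m : Multiset ℝ, 2 * ((m.map (X - C ·)).prod.coeff 0 * (m.map (X - C ·)).prod.coeff 2)
      ≤ (m.map (X - C ·)).prod.coeff 1 ^ 2 := by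
    intro m
    induction m using Multiset.induction_on with
    | empty => simp [coeff_one]
    | cons a m ih =>
      simp only [Multiset.map_cons, Multiset.prod_cons]
      generalize (m.map (X - C ·)).prod = h at ih ⊢
      have e0 : ((X - C a) * h).coeff 0 = - a * h.coeff 0 := by simp [sub_mul]
      have e1 : ((X - C a) * h).coeff 1 = h.coeff 0 - a * h.coeff 1 := by
        have := coeff_X_mul h 0
        simp only [zero_add] at this
        simp [sub_mul, this]
      have e2 : ((X - C a) * h).coeff 2 = h.coeff 1 - a * h.coeff 2 := by
        have := coeff_X_mul h 1
        simp only [Nat.reduceAdd] at this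
        simp [sub_mul, this]
      rw [e0, e1, e2]
      nlinarith [sq_nonneg (h.coeff 0), mul_nonneg (sq_nonneg a) (sub_nonneg.2 ih)]
  have := key m
  rw [hm]
  simp only [coeff_C_mul]
  nlinarith [mul_nonneg (sq_nonneg f.leadingCoeff) (sub_nonneg.2 this)]

open Polynomial in
lemma aux_newton_strong (m : ℕ) : ∀ {f : ℝ[X]}, f.Splits →
    ((m : ℝ) + 2) * (f.coeff m * f.coeff (m + 2)) ≤ (m + 1) * f.coeff (m + 1) ^ 2 := by
  induction m with
  | zero => intro f hf; simpa using aux_newton_zero hf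
  | succ m ih =>
    intro f hf
    have h := ih (aux_splits_derivative hf)
    simp only [coeff_derivative] at h
    push_cast at h ⊢
    have hp : (0 : ℝ) < ((m : ℝ) + 1) * (m + 2) := by positivity
    have e : m + 1 + 2 = m + 2 + 1 := by ring
    rw [e]
    have e3 : m + 1 + 1 = m + 2 := by ring
    rw [e3] at h ⊢
    refine le_of_mul_le_mul_left ?_ hp
    nlinarith [h]

open Polynomial in
lemma aux_newton (m : ℕ) {f : ℝ[X]} (hf : f.Splits) :
    f.coeff m * f.coeff (m + 2) ≤ f.coeff (m + 1) ^ 2 := by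
  have h := aux_newton_strong m hf
  have hp : (0 : ℝ) < (m : ℝ) + 2 := by positivity
  refine le_of_mul_le_mul_left ?_ hp
  nlinarith [sq_nonneg (f.coeff (m + 1))]

lemma aux_real {A a b c : ℝ} (ha : 0 < a) 
    (h : ∀ δ : ℝ, 0 < δ → δ * a * (A + δ * c) ≤ (δ * b) ^ 2) (h' : 0 < A) : False := by
  have h1 : ∀ δ : ℝ, 0 < δ → a * A ≤ δ * (b ^ 2 + |a * c|) := by
    intro δ hδ
    have := h δ hδ
    have h2 : a * (A + δ * c) ≤ δ * b ^ 2 := by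
      refine le_of_mul_le_mul_left ?_ hδ
      nlinarith
    have h3 := neg_abs_le (a * c)
    nlinarith
  have hB : 0 < b ^ 2 + |a * c| + 1 := by positivity
  have hpos : 0 < a * A := mul_pos ha h'
  have := h1 (a * A / (b ^ 2 + |a * c| + 1) / 2) (by positivity)
  have h4 : a * A / (b ^ 2 + |a * c| + 1) / 2 * (b ^ 2 + |a * c| + 1) = a * A / 2 := by
    field_simp
  have h5 : 0 < a * A / (b ^ 2 + |a * c| + 1) / 2 := by positivity
  nlinarith

open Polynomial in
lemma aux_interlace (k : ℕ) (P Q : ℝ[X]) (hP0 : P.coeff 0 = 1) (hQ0 : Q.coeff 0 = 1)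
    (hs : ∀ s : ℝ, (P + C s * (X * Q)).Splits)
    (hP : ∀ j, j ≤ k → 0 < P.coeff j) : ∀ j, j + 1 ≤ k → 0 < Q.coeff j := by
  have c0 : ∀ s : ℝ, (P + C s * (X * Q)).coeff 0 = P.coeff 0 := by intro s; simp
  have c1 : ∀ (s : ℝ) (j : ℕ), (P + C s * (X * Q)).coeff (j + 1) = P.coeff (j + 1) + s * Q.coeff j := by
    intro s j; simp
  have main : ∀ j, j + 2 ≤ k → 0 < Q.coeff j ∧ 0 < Q.coeff (j + 1) ∧
      P.coeff (j + 2) * Q.coeff j ≤ P.coeff (j + 1) * Q.coeff (j + 1) := by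
    intro j
    induction j with
    | zero =>
      intro hk
      have h := aux_newton 0 (hs (- P.coeff 1))
      have e2 := c1 (- P.coeff 1) 1
      have e1 := c1 (- P.coeff 1) 0
      simp only [zero_add, Nat.reduceAdd] at h e1 e2 ⊢
      rw [c0, e1, e2, hP0, hQ0] at h
      have p1 := hP 1 (by omega)
      have p2 := hP 2 (by omega)
      have h' : P.coeff 2 ≤ P.coeff 1 * Q.coeff 1 := by nlinarith
      refine ⟨by rw [hQ0]; norm_num, ?_, by rw [hQ0]; linarith⟩
      by_contra hc
      nlinarith
    | succ j ih =>
      intro hk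
      obtain ⟨q0, q1, hq⟩ := ih (by omega)
      have p1 := hP (j + 1) (by omega)
      have p2 := hP (j + 2) (by omega)
      have p3 := hP (j + 3) (by omega)
      have e : j + 1 + 2 = j + 3 := by ring
      have e' : j + 1 + 1 = j + 2 := by ring
      rw [e, e']
      have hA : P.coeff (j + 3) * Q.coeff (j + 1) ≤ P.coeff (j + 2) * Q.coeff (j + 2) := by
        by_contra hc
        push Not at hc
        set r := P.coeff (j + 2) / Q.coeff (j + 1) with hr
        have hr' : P.coeff (j + 2) = r * Q.coeff (j + 1) := by rw [hr]; field_simp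
        refine aux_real (A := P.coeff (j + 3) - r * Q.coeff (j + 2)) (a := Q.coeff j)
          (b := Q.coeff (j + 1)) (c := Q.coeff (j + 2)) q0 ?_ ?_
        · intro δ hδ
          have h := aux_newton (j + 1) (hs (δ - r))
          rw [c1, e, e', c1 _ (j + 2), c1 _ (j + 1), hr'] at h
          have f1 : δ * Q.coeff j ≤ P.coeff (j + 1) + (δ - r) * Q.coeff j := by
            have : r * Q.coeff j ≤ P.coeff (j + 1) := by
              refine le_of_mul_le_mul_right ?_ q1
              rw [hr'] at hq
              linarith
            linarith
          by_cases hneg : P.coeff (j + 3) - r * Q.coeff (j + 2) + δ * Q.coeff (j + 2) ≤ 0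
          · have : δ * Q.coeff j * (P.coeff (j + 3) - r * Q.coeff (j + 2) + δ * Q.coeff (j + 2)) ≤ 0 :=
              mul_nonpos_of_nonneg_of_nonpos (by positivity) hneg
            exact this.trans (sq_nonneg _)
          · push Not at hneg
            have := mul_le_mul_of_nonneg_right f1 hneg.le
            nlinarith
        · rw [hr'] at hc
          have : 0 < (P.coeff (j + 3) - r * Q.coeff (j + 2)) * Q.coeff (j + 1) := by linarith
          exact pos_of_mul_pos_left this q1.le
      refine ⟨q1, ?_, hA⟩
      exact pos_of_mul_pos_right (lt_of_lt_of_le (mul_pos p3 q1) hA) p2.le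
  intro j hj
  rcases j with _ | j
  · rw [hQ0]; norm_num
  · exact (main j (by omega)).2.1

/-- The polynomial `∏ (1 + f i X)`. -/
noncomputable def genPoly {ι : Type*} (s : Finset ι) (f : ι → ℝ) : Polynomial ℝ :=
  ∏ i ∈ s, (1 + Polynomial.C (f i) * Polynomial.X)

open Polynomial in
lemma genPoly_coeff {ι : Type*} (s : Finset ι) (f : ι → ℝ) (j : ℕ) :
    (genPoly s f).coeff j = ∑ t ∈ s.powersetCard j, ∏ i ∈ t, f i := by
  unfold genPoly
  rw [Finset.prod_one_add, finsetSum_coeff, Finset.powersetCard_eq_filter, Finset.sum_filter]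
  refine Finset.sum_congr rfl fun t _ => ?_
  rw [Finset.prod_mul_distrib, Finset.prod_const, ← map_prod, coeff_C_mul_X_pow]
  simp [eq_comm]

open Polynomial in
lemma genPoly_splits {ι : Type*} (s : Finset ι) (f : ι → ℝ) : (genPoly s f).Splits := by
  refine Splits.prod fun i _ => ?_
  refine Splits.of_natDegree_le_one ?_
  compute_degree

open Polynomial in
lemma genPoly_coeff_zero {ι : Type*} (s : Finset ι) (f : ι → ℝ) : (genPoly s f).coeff 0 = 1 := by
  simp [genPoly_coeff]

open Polynomial in
lemma esymm_shift (n j : ℕ) (hj : j ≤ n) (l : Fin n → ℝ) (ε : ℝ) (hε : 0 < ε)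
    (h : ∀ i, 1 ≤ i → i ≤ j → 0 ≤ esymm n i l) : 0 < esymm n j (fun i => l i + ε) := by
  have h0 : esymm n 0 l = 1 := by simp [esymm]
  set F : ℝ[X] := ∏ i : Fin n, (X + C (l i)) with hF
  have hc : ∀ i, i ≤ n → F.coeff (n - i) = esymm n i l := by
    intro i hi
    rw [hF, Finset.prod_X_add_C_coeff _ _ (by simp)]
    simp [esymm, Nat.sub_sub_self hi]
  have hT : taylor ε F = ∏ i : Fin n, (X + C (l i + ε)) := by
    rw [taylor_apply, hF, Polynomial.prod_comp]
    refine Finset.prod_congr rfl fun i _ => ?_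
    simp; ring
  have h1 : esymm n j (fun i => l i + ε) = (taylor ε F).coeff (n - j) := by
    rw [hT, Finset.prod_X_add_C_coeff _ _ (by simp)]
    simp [esymm, Nat.sub_sub_self hj]
  have hdeg : (hasseDeriv (n - j) F).natDegree < j + 1 := by
    have hFd : F.natDegree = n := by simp [hF, natDegree_prod_of_monic, monic_X_add_C]
    have := natDegree_hasseDeriv_le F (n - j)
    omega
  rw [h1, taylor_coeff, eval_eq_sum_range' hdeg]
  have ht : ∀ i ∈ Finset.range (j + 1), 0 ≤ (hasseDeriv (n - j) F).coeff i * ε ^ i := by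
    intro i hi
    have hi' : i ≤ j := by simpa [Nat.lt_succ_iff] using hi
    rw [hasseDeriv_coeff]
    have : i + (n - j) = n - (j - i) := by omega
    rw [this, hc _ (by omega)]
    have : 0 ≤ esymm n (j - i) l := by
      rcases Nat.eq_zero_or_pos (j - i) with h2 | h2
      · rw [h2, h0]; norm_num
      · exact h _ h2 (by omega)
    positivity
  refine lt_of_lt_of_le ?_ (Finset.single_le_sum ht (Finset.mem_range.2 (Nat.lt_succ_self j)))
  rw [hasseDeriv_coeff]
  have e : j + (n - j) = n - 0 := by omega
  rw [e, hc 0 (by omega), h0]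
  have : 0 < (n - 0).choose (n - j) := Nat.choose_pos (by omega)
  positivity

lemma esymm_continuous (n j : ℕ) : Continuous (esymm n j) := by
  unfold esymm
  fun_prop

lemma closure_nonneg {n k : ℕ} {l : Fin n → ℝ} (h : l ∈ closure (GammaCone n k)) (j : ℕ)
    (h1 : 1 ≤ j) (hk : j ≤ k) : 0 ≤ esymm n j l := by
  have hcl : IsClosed {l : Fin n → ℝ | 0 ≤ esymm n j l} :=
    isClosed_le continuous_const (esymm_continuous n j)
  exact closure_minimal (fun x hx => (hx j h1 hk).le) hcl h

lemma mem_closure_of_nonneg {n k : ℕ} (hkn : k ≤ n) {l : Fin n → ℝ}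
    (h : ∀ j, 1 ≤ j → j ≤ k → 0 ≤ esymm n j l) : l ∈ closure (GammaCone n k) := by
  have ht : Tendsto (fun ε : ℝ => fun i => l i + ε) (nhdsWithin 0 (Ioi 0)) (nhds l) := by
    have : Continuous (fun ε : ℝ => fun i => l i + ε) := by fun_prop
    have h2 := this.tendsto 0
    simp only [add_zero] at h2
    exact h2.mono_left nhdsWithin_le_nhds
  refine mem_closure_of_tendsto ht ?_
  filter_upwards [self_mem_nhdsWithin] with ε hε j h1 hj
  exact esymm_shift n j (hj.trans hkn) l ε hε fun i hi hij => h i hi (hij.trans hj)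

lemma spec_eigenvalues {n : ℕ} (W : Matrix (Fin n) (Fin n) ℝ) (hW : W.IsHermitian) (t : ℝ) :
    (t • (1 : Matrix (Fin n) (Fin n) ℝ) + W).det = ∏ i, (t + hW.eigenvalues i) := by
  have h := congrArg (Polynomial.eval (-t)) hW.charpoly_eq
  rw [Matrix.eval_charpoly, Polynomial.eval_prod] at h
  have e : Matrix.scalar (Fin n) (-t) - W = -(t • (1 : Matrix (Fin n) (Fin n) ℝ) + W) := by
    ext i j
    by_cases hij : i = j <;> simp [hij, Matrix.one_apply] <;> ring
  have e2 : ∏ i, Polynomial.eval (-t) (Polynomial.X - Polynomial.C ((hW.eigenvalues i : ℝ))) =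
      (-1) ^ n * ∏ i, (t + hW.eigenvalues i) := by
    have : ∀ i, Polynomial.eval (-t) (Polynomial.X - Polynomial.C ((hW.eigenvalues i : ℝ))) =
      (-1) * (t + hW.eigenvalues i) := by intro i; simp; ring
    simp_rw [this]
    rw [Finset.prod_mul_distrib]
    simp
  rw [e, Matrix.det_neg] at h
  simp only [Fintype.card_fin] at h
  exact mul_left_cancel₀ (pow_ne_zero n (by norm_num)) (h.trans e2)

/-- The determinant of an arrow matrix. -/
lemma det_arrow {m : ℕ} (W : Matrix (Fin (m + 1)) (Fin (m + 1)) ℝ) (hW : W.IsHermitian)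
    (hoff : ∀ i j : Fin m, i ≠ j → W i.castSucc j.castSucc = 0)
    (hd : ∀ i : Fin m, W i.castSucc i.castSucc ≠ 0) :
    W.det = W (Fin.last m) (Fin.last m) * ∏ i : Fin m, W i.castSucc i.castSucc
      - ∑ i : Fin m, W i.castSucc (Fin.last m) ^ 2 *
        ∏ l ∈ Finset.univ.erase i, W l.castSucc l.castSucc := by
  set d : Fin m → ℝ := fun i => W i.castSucc i.castSucc with hdd
  have hsub : W.submatrix (finSumFinEquiv (m := m) (n := 1)) (finSumFinEquiv (m := m) (n := 1)) =
      Matrix.fromBlocks (Matrix.diagonal d) (Matrix.of fun i _ => W i.castSucc (Fin.last m))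
        (Matrix.of fun _ i => W i.castSucc (Fin.last m))
        (Matrix.of fun _ _ => W (Fin.last m) (Fin.last m)) := by
    have hl : ∀ a : Fin 1, Fin.natAdd m a = Fin.last m := by
      intro a; ext; simp
    have hsym : ∀ a b, W a b = W b a := by
      intro a b
      have := hW.apply a b
      simpa using this.symm
    ext a b
    rcases a with a | a <;> rcases b with b | b
    · by_cases hab : a = b
      · subst hab
        simp [hdd]
        rfl
      · simp [hab]
        exact hoff a b hab
    · simp [hl]
      rfl
    · simp [hl]
      exact hsym _ _
    · simp [hl]
  rw [← Matrix.det_submatrix_equiv_self (finSumFinEquiv (m := m) (n := 1)) W, hsub]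
  letI : Invertible (Matrix.diagonal d) := by
    letI : Invertible d := ⟨fun i => (d i)⁻¹, by ext i; simp [hd i, hdd], by ext i; simp [hd i, hdd]⟩
    exact Matrix.diagonalInvertible d
  rw [Matrix.det_fromBlocks₁₁, Matrix.det_diagonal]
  have hinv : ⅟(Matrix.diagonal d) = Matrix.diagonal (fun i => (d i)⁻¹) := by
    refine invOf_eq_right_inv ?_
    rw [Matrix.diagonal_mul_diagonal, ← Matrix.diagonal_one]
    congr 1
    ext i
    exact mul_inv_cancel₀ (hd i)
  rw [hinv]
  rw [Matrix.det_unique, Matrix.sub_apply, Matrix.mul_apply]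
  simp only [Matrix.of_apply, Matrix.mul_diagonal]
  rw [mul_sub, Finset.mul_sum, mul_comm]
  congr 1
  refine Finset.sum_congr rfl fun i _ => ?_
  rw [← Finset.mul_prod_erase Finset.univ d (Finset.mem_univ i)]
  have := hd i
  change d i ≠ 0 at this
  field_simp

open Polynomial in
lemma poly_arrow {m : ℕ} (W : Matrix (Fin (m + 1)) (Fin (m + 1)) ℝ) (hW : W.IsHermitian)
    (hoff : ∀ i j : Fin m, i ≠ j → W i.castSucc j.castSucc = 0) (μ : Fin (m + 1) → ℝ)
    (hμ : ∀ t : ℝ, (t • (1 : Matrix (Fin (m + 1)) (Fin (m + 1)) ℝ) + W).det = ∏ i, (t + μ i)) :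
    genPoly Finset.univ μ =
      (1 + C (W (Fin.last m) (Fin.last m)) * X) *
        genPoly Finset.univ (fun i : Fin m => W i.castSucc i.castSucc)
      - X ^ 2 * ∑ i : Fin m, C (W i.castSucc (Fin.last m) ^ 2) *
        genPoly (Finset.univ.erase i) (fun i : Fin m => W i.castSucc i.castSucc) := by
  refine eq_of_infinite_eval_eq _ _ ?_
  set d : Fin m → ℝ := fun i => W i.castSucc i.castSucc with hd
  have hQ : genPoly Finset.univ d ≠ 0 := by
    intro h
    have := genPoly_coeff_zero Finset.univ d
    rw [h] at this
    simp at this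
  have hXQ : X * genPoly Finset.univ d ≠ 0 := mul_ne_zero X_ne_zero hQ
  have hfin : Set.Finite {x : ℝ | (X * genPoly Finset.univ d).IsRoot x} := by
    exact Polynomial.finite_setOf_isRoot hXQ
  refine hfin.infinite_compl.mono ?_
  intro x hx
  simp only [Set.mem_compl_iff, Set.mem_setOf_eq, IsRoot.def, eval_mul, eval_X, mul_eq_zero,
    not_or, genPoly, eval_prod, Finset.prod_eq_zero_iff, not_exists] at hx
  obtain ⟨hx0, hxd⟩ := hx
  have hxd' : ∀ i, x⁻¹ + d i ≠ 0 := by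
    intro i h0
    apply hxd i
    refine ⟨Finset.mem_univ _, ?_⟩
    simp only [eval_add, eval_one, eval_mul, eval_C, eval_X]
    have : x * (x⁻¹ + d i) = 0 := by rw [h0, mul_zero]
    rw [mul_add, mul_inv_cancel₀ hx0] at this
    linarith
  have hH : (x⁻¹ • (1 : Matrix (Fin (m + 1)) (Fin (m + 1)) ℝ) + W).IsHermitian := by
    refine Matrix.IsHermitian.add ?_ hW
    ext i j
    by_cases hij : i = j
    · subst hij; simp
    · simp [hij, Ne.symm hij, Matrix.one_apply]
  have hdet := det_arrow _ hH (fun i j hij => by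
      simp [hoff i j hij, hij])
    (fun i => by simpa using hxd' i)
  rw [hμ] at hdet
  have hll : ∀ i : Fin m, i.castSucc ≠ Fin.last m := fun i => (Fin.castSucc_lt_last i).ne
  simp only [Matrix.add_apply, Matrix.smul_apply, Matrix.one_apply_eq, smul_eq_mul, mul_one,
    Matrix.one_apply_ne (hll _), mul_zero, zero_add] at hdet
  have gen : ∀ {ι : Type} (s : Finset ι) (f : ι → ℝ),
      (genPoly s f).eval x = x ^ s.card * ∏ i ∈ s, (x⁻¹ + f i) := by
    intro ι s f
    rw [genPoly, eval_prod, ← Finset.prod_const, ← Finset.prod_mul_distrib]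
    refine Finset.prod_congr rfl fun i _ => ?_
    simp only [eval_add, eval_one, eval_mul, eval_C, eval_X]
    field_simp
  simp only [Set.mem_setOf_eq, eval_sub, eval_mul, eval_add, eval_one, eval_C, eval_X, eval_pow,
    eval_finset_sum, gen]
  rw [hdet]
  simp only [Finset.card_univ, Fintype.card_fin]
  rw [mul_sub, Finset.mul_sum, Finset.mul_sum]
  congr 1
  · rw [pow_succ]
    have : x * (x⁻¹ + W (Fin.last m) (Fin.last m)) = 1 + W (Fin.last m) (Fin.last m) * x := by
      field_simp
    rw [← this]
    ring
  · refine Finset.sum_congr rfl fun i _ => ?_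
    have hc : (Finset.univ.erase i).card + 1 = m := by
      rw [Finset.card_erase_add_one (Finset.mem_univ i)]; simp
    have : x ^ (m + 1) = x ^ 2 * x ^ (Finset.univ.erase i).card := by
      rw [← pow_add]; congr 1; omega
    rw [this]
    ring

open Polynomial in
lemma arrow_pos {m k : ℕ} (W : Matrix (Fin (m + 1)) (Fin (m + 1)) ℝ) (hW : W.IsHermitian)
    (hoff : ∀ i j : Fin m, i ≠ j → W i.castSucc j.castSucc = 0) (μ : Fin (m + 1) → ℝ)
    (hμ : ∀ t : ℝ, (t • (1 : Matrix (Fin (m + 1)) (Fin (m + 1)) ℝ) + W).det = ∏ i, (t + μ i))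
    (hpos : ∀ j, j ≤ k → 0 < (genPoly Finset.univ μ).coeff j) (i : Fin m) (j : ℕ)
    (hj : j + 2 ≤ k) :
    0 < (genPoly (Finset.univ.erase i) (fun i : Fin m => W i.castSucc i.castSucc)).coeff j := by
  set d : Fin m → ℝ := fun i => W i.castSucc i.castSucc with hd
  have hQ : ∀ j, j + 1 ≤ k → 0 < (genPoly Finset.univ d).coeff j := by
    refine aux_interlace k _ _ (genPoly_coeff_zero _ _) (genPoly_coeff_zero _ _) ?_ hpos
    intro s
    set E : Matrix (Fin (m + 1)) (Fin (m + 1)) ℝ :=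
      Matrix.diagonal (Pi.single (Fin.last m) s) with hE
    have hll : ∀ i : Fin m, i.castSucc ≠ Fin.last m := fun i => (Fin.castSucc_lt_last i).ne
    have hWE : (W + E).IsHermitian := by
      refine hW.add ?_
      exact Matrix.isHermitian_diagonal _
    have hoff' : ∀ i j : Fin m, i ≠ j → (W + E) i.castSucc j.castSucc = 0 := by
      intro i j hij
      simp [hE, hoff i j hij, hij]
    have h1 := poly_arrow (W + E) hWE hoff' _ (spec_eigenvalues _ hWE)
    have h2 := poly_arrow W hW hoff μ hμ
    have e1 : (fun i : Fin m => (W + E) i.castSucc i.castSucc) = d := by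
      ext i
      simp [hE, hd, hll]
    have e2 : (W + E) (Fin.last m) (Fin.last m) = W (Fin.last m) (Fin.last m) + s := by
      simp [hE]
    have e3 : ∀ i : Fin m, (W + E) i.castSucc (Fin.last m) = W i.castSucc (Fin.last m) := by
      intro i
      simp [hE, hll]
    simp only [e1, e2, e3] at h1
    have h3 : genPoly Finset.univ μ + C s * (X * genPoly Finset.univ d) =
        genPoly Finset.univ hWE.eigenvalues := by
      rw [h1, h2, C_add]
      ring
    rw [h3]
    exact genPoly_splits _ _
  refine aux_interlace (k - 1) (genPoly Finset.univ d) _ (genPoly_coeff_zero _ _)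
    (genPoly_coeff_zero _ _) ?_ (fun j hj => ?_) j (by omega)
  · intro s
    have : genPoly Finset.univ d + C s * (X * genPoly (Finset.univ.erase i) d) =
        (1 + C (d i + s) * X) * genPoly (Finset.univ.erase i) d := by
      have h0 : genPoly Finset.univ d = (1 + C (d i) * X) * genPoly (Finset.univ.erase i) d := by
        unfold genPoly
        rw [Finset.mul_prod_erase Finset.univ (fun i => 1 + C (d i) * X) (Finset.mem_univ i)]
      rw [h0, C_add]
      ring
    rw [this]
    refine Splits.mul (Splits.of_natDegree_le_one (by compute_degree)) (genPoly_splits _ _)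
  · rcases Nat.eq_zero_or_pos j with h | h
    · rw [h, genPoly_coeff_zero]; norm_num
    · exact hQ j (by omega)

lemma esymm_eq_coeff (n j : ℕ) (l : Fin n → ℝ) :
    esymm n j l = (genPoly Finset.univ l).coeff j := (genPoly_coeff _ _ _).symm

lemma arrow_nonneg {m k : ℕ} (hk : k ≤ m + 1) (W : Matrix (Fin (m + 1)) (Fin (m + 1)) ℝ)
    (hW : W.IsHermitian)
    (hoff : ∀ i j : Fin m, i ≠ j → W i.castSucc j.castSucc = 0)
    (hnn : ∀ j, 1 ≤ j → j ≤ k → 0 ≤ esymm (m + 1) j hW.eigenvalues) (i : Fin m) (j : ℕ)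
    (hj : j + 2 ≤ k) :
    0 ≤ (genPoly (Finset.univ.erase i) (fun i : Fin m => W i.castSucc i.castSucc)).coeff j := by
  have hp : ∀ ε : ℝ, 0 < ε →
      0 < (genPoly (Finset.univ.erase i)
        (fun i : Fin m => W i.castSucc i.castSucc + ε)).coeff j := by
    intro ε hε
    have hH : (W + ε • (1 : Matrix (Fin (m + 1)) (Fin (m + 1)) ℝ)).IsHermitian := by
      refine hW.add ?_
      ext i j
      by_cases hij : i = j
      · subst hij; simp
      · simp [hij, Ne.symm hij, Matrix.one_apply]
    have h := arrow_pos (k := k) (W + ε • (1 : Matrix (Fin (m + 1)) (Fin (m + 1)) ℝ)) hH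
      (fun i j hij => by simp [hoff i j hij, hij]) (fun i => hW.eigenvalues i + ε)
      (fun t => by
        have := spec_eigenvalues W hW (t + ε)
        rw [add_smul] at this
        rw [show t • (1 : Matrix (Fin (m + 1)) (Fin (m + 1)) ℝ) + (W + ε • 1) =
          t • 1 + ε • 1 + W by abel, this]
        refine Finset.prod_congr rfl fun i _ => by ring)
      (fun j hj => by
        rw [← esymm_eq_coeff]
        exact esymm_shift _ _ (hj.trans hk) _ _ hε fun i h1 h2 => hnn i h1 (h2.trans hj))
      i j hj
    simpa using h
  have hc : Continuous (fun ε : ℝ => (genPoly (Finset.univ.erase i)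
        (fun i : Fin m => W i.castSucc i.castSucc + ε)).coeff j) := by
    simp only [genPoly_coeff]
    fun_prop
  have ht := (hc.tendsto 0).mono_left (nhdsWithin_le_nhds (s := Ioi 0))
  simp only [add_zero] at ht
  refine ge_of_tendsto ht ?_
  filter_upwards [self_mem_nhdsWithin] with ε hε
  exact (hp ε hε).le

/-- If a symmetric matrix `W` has its only off-diagonal entries in the last row and
column, and `λ(W) ∈ Γ̄_k`, then `σ_j(diag W) ≥ σ_j(λ(W)) ≥ 0` for `1 ≤ j ≤ k`,
and the diagonal of `W` also lies in `Γ̄_k`. -/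
theorem stmt5 (n k : ℕ) (hn : 1 ≤ n) (hk : 1 ≤ k) (hkn : k ≤ n)
    (W : Matrix (Fin n) (Fin n) ℝ) (hW : W.IsHermitian)
    (hoff : ∀ i j : Fin n, i ≠ j → (i : ℕ) < n - 1 → (j : ℕ) < n - 1 → W i j = 0)
    (heig : hW.eigenvalues ∈ closure (GammaCone n k)) :
    (∀ j : ℕ, 1 ≤ j → j ≤ k →
      0 ≤ esymm n j hW.eigenvalues ∧
      esymm n j hW.eigenvalues ≤ esymm n j (fun i => W i i)) ∧
    (fun i => W i i) ∈ closure (GammaCone n k) := by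
  have hnn := fun j h1 hj => closure_nonneg heig j h1 hj
  have hmain : ∀ j : ℕ, 1 ≤ j → j ≤ k →
      0 ≤ esymm n j hW.eigenvalues ∧
      esymm n j hW.eigenvalues ≤ esymm n j (fun i => W i i) := by
    intro j h1 hj
    refine ⟨hnn j h1 hj, ?_⟩
    obtain ⟨m, rfl⟩ : ∃ m, n = m + 1 := ⟨n - 1, by omega⟩
    have hoff' : ∀ i j : Fin m, i ≠ j → W i.castSucc j.castSucc = 0 := by
      intro i j hij
      exact hoff _ _ (fun h => hij (Fin.castSucc_injective _ h)) (by simp) (by simp)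
    have h := poly_arrow W hW hoff' _ (spec_eigenvalues W hW)
    have hdiag : genPoly Finset.univ (fun i => W i i) =
        (1 + Polynomial.C (W (Fin.last m) (Fin.last m)) * Polynomial.X) *
        genPoly Finset.univ (fun i : Fin m => W i.castSucc i.castSucc) := by
      unfold genPoly
      rw [Fin.prod_univ_castSucc, mul_comm]
    rw [← hdiag] at h
    rw [esymm_eq_coeff, esymm_eq_coeff, h, Polynomial.coeff_sub, sub_le_self_iff,
      Polynomial.coeff_X_pow_mul']
    split_ifs with h2
    · rw [Polynomial.finsetSum_coeff]
      refine Finset.sum_nonneg fun i _ => ?_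
      rw [Polynomial.coeff_C_mul]
      exact mul_nonneg (sq_nonneg _) (arrow_nonneg hkn W hW hoff' hnn i (j - 2) (by omega))
    · exact le_rfl
  exact ⟨hmain, mem_closure_of_nonneg hkn fun j h1 hj => (hmain j h1 hj).1.trans (hmain j h1 hj).2⟩
end

section
/- Let u₁, u₂ : ℝⁿ → ℝ be smooth functions such that for each i and each x, the matrix U_i(x) = D²u_i(x) − (|Du_i(x)|²/(2u_i(x))) I + u_i(x) A(x) has eigenvalues in Γ̄_k, where A is a fixed smooth symmetric-matrix-valued function and u_i > 0. Then at every point x where u := max(u₁, u₂) is twice differentiable, the matrix D²u(x) − (|Du(x)|²/(2u(x))) I + u(x) A(x) has eigenvalues in Γ̄_k. -/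
open Set Filter Asymptotics
open scoped Topology

/-- Second partial derivatives (Hessian matrix) of a function on `ℝⁿ`. -/
noncomputable def hessPi (n : ℕ) (f : (Fin n → ℝ) → ℝ) (x : Fin n → ℝ) :
    Matrix (Fin n) (Fin n) ℝ :=
  fun i j => fderiv ℝ (fun y => fderiv ℝ f y (Pi.single j 1)) x (Pi.single i 1)

/-- The conformal `k`-Hessian matrix `D²u - (|Du|²/(2u)) I + u A`. -/
noncomputable def confMat (n : ℕ) (A : (Fin n → ℝ) → Matrix (Fin n) (Fin n) ℝ)
    (u : (Fin n → ℝ) → ℝ) (x : Fin n → ℝ) : Matrix (Fin n) (Fin n) ℝ :=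
  fun i j => hessPi n u x i j
    - (∑ l, (fderiv ℝ u x (Pi.single l 1)) ^ 2) / (2 * u x) * (if i = j then 1 else 0)
    + u x * A x i j


open Polynomial in
lemma aux_splits_derivative_s9 (p : ℝ[X]) (hp : p.Splits) : (derivative p).Splits := by
  rw [splits_iff_card_roots] at *
  have h1 := card_roots_le_derivative p
  have h2 := card_roots' (derivative p)
  have h3 := natDegree_derivative_le p
  by_cases h0 : p.natDegree = 0
  · omega
  · omega

open Polynomial in
lemma aux_laguerre (p : ℝ[X]) (hp : p.Splits) (x : ℝ) :
    p.eval x * (derivative (derivative p)).eval x ≤ ((derivative p).eval x) ^ 2 := by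
  obtain ⟨m, hm⟩ := splits_iff_exists_multiset.mp hp
  have key : ∀ m : Multiset ℝ, 0 ≤ ((derivative (m.map (fun a => X - C a)).prod).eval x) ^ 2 -
      ((m.map (fun a => X - C a)).prod).eval x *
      (derivative (derivative (m.map (fun a => X - C a)).prod)).eval x := by
    intro m
    induction m using Multiset.induction with
    | empty => simp
    | cons a s ih =>
      set q := (s.map (fun a => X - C a)).prod with hq
      simp only [Multiset.map_cons, Multiset.prod_cons, ← hq]
      simp only [derivative_mul, derivative_add, derivative_sub, derivative_X, derivative_C,
        eval_add, eval_mul, eval_sub, eval_X, eval_C, eval_one, eval_zero, derivative_one,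
        derivative_zero]
      nlinarith [sq_nonneg (q.eval x), mul_nonneg (sq_nonneg (x - a)) ih]
  have h := key m
  rw [hm]
  simp only [derivative_C_mul, eval_mul, eval_C]
  nlinarith [mul_nonneg (sq_nonneg p.leadingCoeff) h]

open Polynomial in
lemma aux_newton_coeff (p : ℝ[X]) (hp : p.Splits) (k : ℕ) :
    p.coeff k * p.coeff (k + 2) ≤ p.coeff (k + 1) ^ 2 := by
  have hs : ∀ k, (derivative^[k] p).Splits := by
    intro k
    induction k with
    | zero => simpa using hp
    | succ k ih =>
      rw [Function.iterate_succ_apply']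
      exact aux_splits_derivative_s9 _ ih
  have h := aux_laguerre _ (hs k) 0
  have e1 : ∀ k, derivative (derivative^[k] p) = derivative^[k + 1] p :=
    fun k => (Function.iterate_succ_apply' _ _ _).symm
  rw [e1, e1,
    ← coeff_zero_eq_eval_zero, ← coeff_zero_eq_eval_zero, ← coeff_zero_eq_eval_zero,
    coeff_iterate_derivative, coeff_iterate_derivative, coeff_iterate_derivative] at h
  simp only [zero_add, Nat.descFactorial_self, nsmul_eq_mul,
    Nat.factorial_succ, Nat.cast_mul] at h
  have hk : (0 : ℝ) < (k.factorial : ℝ) := by exact_mod_cast k.factorial_pos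
  push_cast at h
  have h' : ((k : ℝ) + 1 + 1) * (p.coeff k * p.coeff (k + 2))
      ≤ ((k : ℝ) + 1) * p.coeff (k + 1) ^ 2 := by
    have hc : 0 < ((k.factorial : ℝ)) ^ 2 * ((k : ℝ) + 1) := by positivity
    refine le_of_mul_le_mul_left ?_ hc
    have e : k + 1 + 1 = k + 2 := rfl
    rw [e] at h
    nlinarith [h]
  by_contra hcon
  push Not at hcon
  have hk0 : (0 : ℝ) ≤ k := Nat.cast_nonneg k
  nlinarith [sq_nonneg (p.coeff (k + 1)), mul_lt_mul_of_pos_left hcon (by positivity : (0 : ℝ) < (k : ℝ) + 1)]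

/-- elementary symmetric functions over a finset -/
noncomputable def auxE {n : ℕ} (S : Finset (Fin n)) (l : Fin n → ℝ) (j : ℕ) : ℝ :=
  ∑ s ∈ Finset.powersetCard j S, ∏ i ∈ s, l i

lemma auxE_coeff {n : ℕ} (S : Finset (Fin n)) (l : Fin n → ℝ) (j : ℕ) (hj : j ≤ S.card) :
    (∏ i ∈ S, (Polynomial.X + Polynomial.C (l i))).coeff (S.card - j) = auxE S l j := by
  rw [Finset.prod_X_add_C_coeff _ _ (Nat.sub_le _ _), Nat.sub_sub_self hj, auxE]

lemma auxE_insert {n : ℕ} (S : Finset (Fin n)) (l : Fin n → ℝ) (j : ℕ) (i : Fin n) (hi : i ∉ S) :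
    auxE (insert i S) l (j + 1) = auxE S l (j + 1) + l i * auxE S l j := by
  unfold auxE
  rw [Finset.powersetCard_succ_insert hi, Finset.sum_union, Finset.sum_image, Finset.mul_sum]
  · congr 1
    refine Finset.sum_congr rfl fun s hs => ?_
    rw [Finset.prod_insert]
    exact fun h => hi ((Finset.mem_powersetCard.1 hs).1 h)
  · intro a ha b hb hab
    have ha' : i ∉ a := fun h => hi ((Finset.mem_powersetCard.1 ha).1 h)
    have hb' : i ∉ b := fun h => hi ((Finset.mem_powersetCard.1 hb).1 h)
    rw [← Finset.erase_insert ha', ← Finset.erase_insert hb', hab]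
  · rw [Finset.disjoint_left]
    intro a ha hb
    obtain ⟨b, hb, rfl⟩ := Finset.mem_image.1 hb
    exact hi ((Finset.mem_powersetCard.1 ha).1 (Finset.mem_insert_self _ _))

lemma auxE_newton {n : ℕ} (S : Finset (Fin n)) (l : Fin n → ℝ) (j : ℕ) :
    auxE S l j * auxE S l (j + 2) ≤ auxE S l (j + 1) ^ 2 := by
  by_cases h : j + 2 ≤ S.card
  · have hs : (∏ i ∈ S, (Polynomial.X + Polynomial.C (l i))).Splits :=
      Polynomial.Splits.prod fun i _ => Polynomial.Splits.X_add_C _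
    have h0 := aux_newton_coeff _ hs (S.card - (j + 2))
    rw [show S.card - (j + 2) + 2 = S.card - j by omega,
      show S.card - (j + 2) + 1 = S.card - (j + 1) by omega,
      auxE_coeff _ _ _ h, auxE_coeff _ _ _ (by omega), auxE_coeff _ _ _ (by omega)] at h0
    linarith
  · have : auxE S l (j + 2) = 0 := by
      unfold auxE
      rw [Finset.powersetCard_eq_empty.2 (by omega), Finset.sum_empty]
    rw [this, mul_zero]
    positivity

lemma auxE_erase_pos {n k : ℕ} (S : Finset (Fin n)) (l : Fin n → ℝ) (i : Fin n) (hi : i ∉ S)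
    (h : ∀ j, 1 ≤ j → j ≤ k → 0 < auxE (insert i S) l j) (j : ℕ) (hj : j < k) :
    0 < auxE S l j := by
  induction j with
  | zero => simp [auxE]
  | succ j ih =>
    have ha := ih (by omega)
    have h1 := h (j + 1) (by omega) (by omega)
    have h2 := h (j + 2) (by omega) (by omega)
    rw [auxE_insert _ _ _ _ hi] at h1 h2
    have hN := auxE_newton S l j
    by_contra hb
    push Not at hb
    nlinarith [mul_pos ha h2, mul_nonneg (neg_nonneg.2 hb) h1.le]

/-- `M` has "spectrum" `l`, expressed through `det (t + M)`. -/
def auxSpec {n : ℕ} (M : Matrix (Fin n) (Fin n) ℝ) (l : Fin n → ℝ) : Prop :=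
  ∀ t : ℝ, (t • (1 : Matrix (Fin n) (Fin n) ℝ) + M).det = ∏ i, (t + l i)

lemma auxSpec_diagonal {n : ℕ} (l : Fin n → ℝ) : auxSpec (Matrix.diagonal l) l := by
  intro t
  rw [Matrix.smul_one_eq_diagonal, Matrix.diagonal_add, Matrix.det_diagonal]

lemma auxSpec_shift {n : ℕ} {M : Matrix (Fin n) (Fin n) ℝ} {l : Fin n → ℝ} (h : auxSpec M l)
    (ε : ℝ) : auxSpec (M + ε • 1) (fun i => l i + ε) := by
  intro t
  have := h (t + ε)
  rw [add_smul] at this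
  rw [show t • (1 : Matrix (Fin n) (Fin n) ℝ) + (M + ε • 1) = t • 1 + ε • 1 + M by abel, this]
  exact Finset.prod_congr rfl fun i _ => by ring

lemma auxSpec_conj {n : ℕ} (M U V : Matrix (Fin n) (Fin n) ℝ) (hUV : U * V = 1) (t : ℝ) :
    (t • (1 : Matrix (Fin n) (Fin n) ℝ) + U * M * V).det = (t • 1 + M).det := by
  have h : t • (1 : Matrix (Fin n) (Fin n) ℝ) + U * M * V = U * (t • 1 + M) * V := by
    rw [mul_add, add_mul, mul_smul_comm, mul_one, smul_mul_assoc, hUV]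
  rw [h, Matrix.det_mul, Matrix.det_mul]
  have := congrArg Matrix.det hUV
  rw [Matrix.det_mul, Matrix.det_one] at this
  linear_combination (t • (1 : Matrix (Fin n) (Fin n) ℝ) + M).det * this

lemma aux_diag {n : ℕ} {M : Matrix (Fin n) (Fin n) ℝ} (hM : M.IsHermitian) :
    ∃ U : Matrix (Fin n) (Fin n) ℝ, U * U.transpose = 1 ∧
      M = U * Matrix.diagonal hM.eigenvalues * U.transpose := by
  refine ⟨hM.eigenvectorUnitary, ?_, ?_⟩
  · have := Unitary.coe_mul_star_self hM.eigenvectorUnitary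
    rwa [Unitary.coe_star, Matrix.star_eq_conjTranspose,
      Matrix.conjTranspose_eq_transpose_of_trivial] at this
  · have := hM.spectral_theorem
    rwa [Unitary.conjStarAlgAut_apply, Matrix.star_eq_conjTranspose,
      Matrix.conjTranspose_eq_transpose_of_trivial] at this

lemma auxSpec_eigenvalues {n : ℕ} {M : Matrix (Fin n) (Fin n) ℝ} (hM : M.IsHermitian) :
    auxSpec M hM.eigenvalues := by
  obtain ⟨U, hU, h⟩ := aux_diag hM
  intro t
  conv_lhs => rw [h]
  rw [auxSpec_conj _ _ _ hU]
  exact auxSpec_diagonal _ t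

lemma aux_esymm_eq {n : ℕ} {l m : Fin n → ℝ} (h : ∀ t : ℝ, ∏ i, (t + l i) = ∏ i, (t + m i))
    (j : ℕ) (hj : j ≤ n) : esymm n j l = esymm n j m := by
  have hp : ∏ i, (Polynomial.X + Polynomial.C (l i)) = ∏ i, (Polynomial.X + Polynomial.C (m i)) := by
    refine Polynomial.funext fun t => ?_
    simpa [Polynomial.eval_prod] using h t
  have h1 := auxE_coeff Finset.univ l j (by simpa using hj)
  have h2 := auxE_coeff Finset.univ m j (by simpa using hj)
  rw [hp, h2] at h1
  exact h1.symm

lemma auxSpec_gamma {n k : ℕ} (hkn : k ≤ n) {M : Matrix (Fin n) (Fin n) ℝ} {l m : Fin n → ℝ}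
    (hl : auxSpec M l) (hm : auxSpec M m) (h : l ∈ GammaCone n k) : m ∈ GammaCone n k := by
  intro j h1 h2
  rw [aux_esymm_eq (l := m) (m := l) (fun t => (hm t).symm.trans (hl t)) j (h2.trans hkn)]
  exact h j h1 h2

lemma aux_det_rank_one {n : ℕ} (d w : Fin n → ℝ) (hd : ∀ i, d i ≠ 0) :
    (Matrix.diagonal d + Matrix.vecMulVec w w).det =
      ∏ i, d i + ∑ i, (w i) ^ 2 * ∏ j ∈ Finset.univ.erase i, d j := by
  have hu : IsUnit (Matrix.diagonal d).det := by
    rw [Matrix.det_diagonal, isUnit_iff_ne_zero]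
    exact Finset.prod_ne_zero_iff.2 fun i _ => hd i
  have hinv : (Matrix.diagonal d)⁻¹ = Matrix.diagonal (fun i => (d i)⁻¹) := by
    apply Matrix.inv_eq_right_inv
    rw [Matrix.diagonal_mul_diagonal, ← Matrix.diagonal_one]
    congr 1
    ext i
    exact mul_inv_cancel₀ (hd i)
  rw [Matrix.vecMulVec_eq Unit, Matrix.det_add_replicateCol_mul_replicateRow hu, hinv,
    Matrix.det_diagonal, Matrix.det_unique, Matrix.add_apply, Matrix.one_apply_eq, mul_add, mul_one]
  congr 1
  simp only [Matrix.mul_apply, Matrix.replicateRow_apply, Matrix.replicateCol_apply,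
    Matrix.diagonal_apply, mul_ite, mul_zero, Finset.sum_ite_eq', Finset.mem_univ, if_true]
  rw [Finset.mul_sum]
  refine Finset.sum_congr rfl fun i _ => ?_
  rw [← Finset.mul_prod_erase Finset.univ d (Finset.mem_univ i)]
  have := hd i
  field_simp

lemma aux_rank_one_poly {n : ℕ} (l w m : Fin n → ℝ)
    (hm : auxSpec (Matrix.diagonal l + Matrix.vecMulVec w w) m) :
    ∏ i, (Polynomial.X + Polynomial.C (m i)) = ∏ i, (Polynomial.X + Polynomial.C (l i)) +
      ∑ i, Polynomial.C ((w i) ^ 2) *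
        ∏ j ∈ Finset.univ.erase i, (Polynomial.X + Polynomial.C (l j)) := by
  apply Polynomial.eq_of_infinite_eval_eq
  have hinf : (Set.Ioi (∑ i, |l i|)).Infinite := Set.Ioi_infinite _
  refine hinf.mono fun t ht => ?_
  have hd : ∀ i, t + l i ≠ 0 := by
    intro i
    have h1 : |l i| ≤ ∑ i, |l i| :=
      Finset.single_le_sum (f := fun i => |l i|) (fun i _ => abs_nonneg _) (Finset.mem_univ i)
    have h2 := neg_abs_le (l i)
    have h3 : ∑ i, |l i| < t := ht
    have : 0 < t + l i := by linarith
    exact this.ne'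
  have h := hm t
  rw [← add_assoc, Matrix.smul_one_eq_diagonal, Matrix.diagonal_add,
    aux_det_rank_one _ _ hd] at h
  simp only [Set.mem_ofPred_eq, Polynomial.eval_prod, Polynomial.eval_add, Polynomial.eval_X,
    Polynomial.eval_C, Polynomial.eval_finsetSum, Polynomial.eval_mul]
  exact h.symm

lemma aux_rank_one_gamma {n k : ℕ} (hkn : k ≤ n) (l w m : Fin n → ℝ)
    (hm : auxSpec (Matrix.diagonal l + Matrix.vecMulVec w w) m) (hl : l ∈ GammaCone n k) :
    m ∈ GammaCone n k := by
  intro j h1 h2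
  have hp := congrArg (fun p => Polynomial.coeff p (n - j)) (aux_rank_one_poly l w m hm)
  simp only [Polynomial.coeff_add, Polynomial.finsetSum_coeff, Polynomial.coeff_C_mul] at hp
  have e1 := auxE_coeff Finset.univ l j (by simp; omega)
  have e2 := auxE_coeff Finset.univ m j (by simp; omega)
  rw [Finset.card_univ, Fintype.card_fin] at e1 e2
  rw [e1, e2] at hp
  change 0 < auxE Finset.univ m j
  rw [hp]
  have hpos : 0 < auxE Finset.univ l j := hl j h1 h2
  refine add_pos_of_pos_of_nonneg hpos (Finset.sum_nonneg fun i _ => mul_nonneg (sq_nonneg _) ?_)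
  have hc : (Finset.univ.erase i).card = n - 1 := by simp
  have e3 := auxE_coeff (Finset.univ.erase i) l (j - 1) (by rw [hc]; omega)
  rw [hc, show n - 1 - (j - 1) = n - j by omega] at e3
  rw [e3]
  refine (auxE_erase_pos (k := k) _ l i (Finset.notMem_erase i _) ?_ (j - 1) (by omega)).le
  rw [Finset.insert_erase (Finset.mem_univ i)]
  exact hl

/-- Hermitian matrices with spectrum in the cone. -/
def auxGM (n k : ℕ) (M : Matrix (Fin n) (Fin n) ℝ) : Prop :=
  M.IsHermitian ∧ ∃ l ∈ GammaCone n k, auxSpec M l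

lemma auxGM_rank_one {n k : ℕ} (hkn : k ≤ n) {M : Matrix (Fin n) (Fin n) ℝ} (hM : auxGM n k M)
    (v : Fin n → ℝ) : auxGM n k (M + Matrix.vecMulVec v v) := by
  obtain ⟨hH, l, hl, hs⟩ := hM
  have hv : (Matrix.vecMulVec v v).IsHermitian := by
    ext i j
    simp [Matrix.vecMulVec_apply, mul_comm]
  have hH' := hH.add hv
  refine ⟨hH', hH'.eigenvalues, ?_, auxSpec_eigenvalues hH'⟩
  have he := auxSpec_gamma hkn hs (auxSpec_eigenvalues hH) hl
  obtain ⟨U, hU, hMU⟩ := aux_diag hH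
  refine aux_rank_one_gamma hkn hH.eigenvalues (U.transpose.mulVec v) _ (fun t => ?_) he
  rw [← auxSpec_eigenvalues hH' t, ← auxSpec_conj _ U U.transpose hU t]
  congr 2
  rw [mul_add, add_mul, ← hMU]
  congr 1
  rw [Matrix.mul_vecMulVec, Matrix.vecMulVec_mul, Matrix.mulVec_mulVec, hU, Matrix.one_mulVec,
    Matrix.mulVec_transpose, Matrix.vecMul_vecMul, hU, Matrix.vecMul_one]

lemma auxGM_add {n k : ℕ} (hkn : k ≤ n) {M P : Matrix (Fin n) (Fin n) ℝ} (hM : auxGM n k M)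
    (hP : P.PosSemidef) : auxGM n k (M + P) := by
  obtain ⟨m, v, rfl⟩ := Matrix.posSemidef_iff_eq_sum_vecMulVec.1 hP
  have : ∀ s : Finset (Fin m), auxGM n k (M + ∑ i ∈ s, Matrix.vecMulVec (v i) (star (v i))) := by
    intro s
    induction s using Finset.induction with
    | empty => simpa using hM
    | insert a s ha ih =>
      rw [Finset.sum_insert ha, add_comm (Matrix.vecMulVec _ _), ← add_assoc, star_trivial]
      exact auxGM_rank_one hkn ih _
  exact this _

lemma aux_gamma_shift {n k : ℕ} (hkn : k ≤ n) {l : Fin n → ℝ} (hl : l ∈ closure (GammaCone n k))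
    {ε : ℝ} (hε : 0 < ε) : (fun i => l i + ε) ∈ GammaCone n k := by
  obtain ⟨m, hm, hd⟩ := Metric.mem_closure_iff.1 hl ε hε
  have h1 : auxGM n k (Matrix.diagonal m) :=
    ⟨Matrix.isHermitian_diagonal _, m, hm, auxSpec_diagonal m⟩
  have hP : (Matrix.diagonal (fun i => l i + ε - m i)).PosSemidef := by
    refine Matrix.PosSemidef.diagonal fun i => ?_
    have := (dist_le_pi_dist l m i).trans_lt hd
    rw [Real.dist_eq, abs_lt] at this
    simp only [Pi.zero_apply]
    linarith
  obtain ⟨-, l', hl', hs⟩ := auxGM_add hkn h1 hP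
  rw [Matrix.diagonal_add] at hs
  refine auxSpec_gamma hkn hs ?_ hl'
  have e : (fun i => m i + (l i + ε - m i)) = fun i => l i + ε := by
    ext i
    ring
  rw [e]
  exact auxSpec_diagonal _

lemma aux_monotone {n k : ℕ} (hkn : k ≤ n) {M N : Matrix (Fin n) (Fin n) ℝ}
    (hM : M.IsHermitian) (hN : N.IsHermitian) (hP : (N - M).PosSemidef)
    (hl : hM.eigenvalues ∈ closure (GammaCone n k)) :
    hN.eigenvalues ∈ closure (GammaCone n k) := by
  have key : ∀ ε : ℝ, 0 < ε → (fun i => hN.eigenvalues i + ε) ∈ GammaCone n k := by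
    intro ε hε
    have h1 : auxGM n k (M + ε • 1) := by
      refine ⟨hM.add ?_, _, aux_gamma_shift hkn hl hε, auxSpec_shift (auxSpec_eigenvalues hM) ε⟩
      rw [Matrix.smul_one_eq_diagonal]
      exact Matrix.isHermitian_diagonal _
    obtain ⟨-, l', hl', hs⟩ := auxGM_add hkn h1 hP
    rw [show M + ε • 1 + (N - M) = N + ε • 1 by abel] at hs
    exact auxSpec_gamma hkn hs (auxSpec_shift (auxSpec_eigenvalues hN) ε) hl'
  have ht : Tendsto (fun ε : ℝ => fun i => hN.eigenvalues i + ε) (𝓝[>] 0) (𝓝 hN.eigenvalues) := by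
    have hc : Continuous (fun ε : ℝ => fun i => hN.eigenvalues i + ε) := by fun_prop
    have := (hc.tendsto 0).mono_left (nhdsWithin_le_nhds (s := Set.Ioi 0))
    simpa using this
  exact mem_closure_of_tendsto ht (by
    filter_upwards [self_mem_nhdsWithin] with ε hε using key ε hε)

lemma aux_le : (2 : WithTop ℕ∞) ≤ ((⊤ : ℕ∞) : WithTop ℕ∞) := by
  have h : ((2 : ℕ∞) : WithTop ℕ∞) ≤ ((⊤ : ℕ∞) : WithTop ℕ∞) := WithTop.coe_le_coe.2 le_top
  exact h

lemma aux_quad (a b : ℝ) (r : ℝ → ℝ) (hr : r =o[𝓝 0] fun t : ℝ => t ^ 2)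
    (h : ∀ t, 0 ≤ a * t + b * t ^ 2 + r t) : a = 0 ∧ 0 ≤ b := by
  have hr2 : Tendsto (fun t => r t / t ^ 2) (𝓝 0) (𝓝 0) := hr.tendsto_div_nhds_zero
  have hid : Tendsto (fun t : ℝ => t) (𝓝 0) (𝓝 0) := tendsto_id
  have h1 : Tendsto (fun t => a + b * t + t * (r t / t ^ 2)) (𝓝 0) (𝓝 a) := by
    have := (tendsto_const_nhds (x := a)).add ((hid.const_mul b)) |>.add (hid.mul hr2)
    simpa using this
  have ha : a = 0 := by
    apply le_antisymm
    · refine le_of_tendsto (h1.mono_left (nhdsWithin_le_nhds (s := Set.Iio 0))) ?_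
      filter_upwards [self_mem_nhdsWithin] with t ht
      have ht' : t < 0 := ht
      have e : a * t + b * t ^ 2 + r t = t * (a + b * t + t * (r t / t ^ 2)) := by
        have := ht'.ne
        field_simp
      have := h t
      rw [e] at this
      exact nonpos_of_mul_nonneg_right this ht'
    · refine ge_of_tendsto (h1.mono_left (nhdsWithin_le_nhds (s := Set.Ioi 0))) ?_
      filter_upwards [self_mem_nhdsWithin] with t ht
      have ht' : 0 < t := ht
      have e : a * t + b * t ^ 2 + r t = t * (a + b * t + t * (r t / t ^ 2)) := by
        have := ht'.ne'
        field_simp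
      have := h t
      rw [e] at this
      exact nonneg_of_mul_nonneg_right this ht'
  refine ⟨ha, ?_⟩
  have h2 : Tendsto (fun t => b + r t / t ^ 2) (𝓝 0) (𝓝 b) := by
    simpa using (tendsto_const_nhds (x := b)).add hr2
  refine ge_of_tendsto (h2.mono_left (nhdsWithin_le_nhds (s := Set.Ioi 0))) ?_
  filter_upwards [self_mem_nhdsWithin] with t ht
  have ht' : 0 < t := ht
  have e : a * t + b * t ^ 2 + r t = t ^ 2 * (b + r t / t ^ 2) := by
    have := ht'.ne'
    rw [ha]
    field_simp
    ring
  have := h t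
  rw [e] at this
  exact nonneg_of_mul_nonneg_right this (by positivity)

lemma aux_fderiv_sum {n : ℕ} (L : (Fin n → ℝ) →L[ℝ] ℝ) (v : Fin n → ℝ) :
    L v = ∑ i, L (Pi.single i 1) * v i := by
  conv_lhs => rw [pi_eq_sum_univ' v]
  rw [map_sum]
  refine Finset.sum_congr rfl fun i _ => ?_
  rw [map_smul, smul_eq_mul, mul_comm]

lemma aux_taylor {n : ℕ} (w : (Fin n → ℝ) → ℝ) (hw : ContDiff ℝ (⊤ : ℕ∞) w)
    (x v : Fin n → ℝ) :
    (fun t : ℝ => w (x + t • v) - w x - t * (∑ i, fderiv ℝ w x (Pi.single i 1) * v i)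
      - t ^ 2 / 2 * ∑ i, ∑ j, hessPi n w x i j * v i * v j) =o[𝓝 0] fun t : ℝ => t ^ 2 := by
  have hφ : ContDiff ℝ 2 (fun t : ℝ => w (x + t • v)) := by
    have hw2 : ContDiff ℝ 2 w := hw.of_le aux_le
    fun_prop
  have hw1 : Differentiable ℝ w := hw.differentiable (by simp)
  have hdw : ContDiff ℝ 1 (fun y => fderiv ℝ w y) := by
    refine hw.fderiv_right (m := 1) ?_
    rw [one_add_one_eq_two]; exact aux_le
  have hline : ∀ t : ℝ, HasDerivAt (fun t : ℝ => x + t • v) v t := by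
    intro t
    simpa using ((hasDerivAt_id t).smul_const v).const_add x
  have hd1 : ∀ t : ℝ, HasDerivAt (fun t : ℝ => w (x + t • v))
      (∑ j, fderiv ℝ w (x + t • v) (Pi.single j 1) * v j) t := by
    intro t
    rw [← aux_fderiv_sum]
    exact (hw1 (x + t • v)).hasFDerivAt.comp_hasDerivAt t (hline t)
  have hd1' : deriv (fun t : ℝ => w (x + t • v)) =
      fun t => ∑ j, fderiv ℝ w (x + t • v) (Pi.single j 1) * v j :=
    funext fun t => (hd1 t).deriv
  have hd2 : HasDerivAt (fun t : ℝ => ∑ j, fderiv ℝ w (x + t • v) (Pi.single j 1) * v j)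
      (∑ i, ∑ j, hessPi n w x i j * v i * v j) 0 := by
    rw [Finset.sum_comm]
    refine HasDerivAt.fun_sum fun j _ => ?_
    rw [← Finset.sum_mul]
    refine HasDerivAt.mul_const ?_ _
    have hdj : Differentiable ℝ (fun y => fderiv ℝ w y (Pi.single j 1)) :=
      (hdw.clm_apply contDiff_const).differentiable (by simp)
    have h0 := (hdj (x + (0 : ℝ) • v)).hasFDerivAt.comp_hasDerivAt (0 : ℝ) (hline 0)
    rw [aux_fderiv_sum] at h0
    simp only [zero_smul, add_zero] at h0
    exact h0
  have ht := taylor_isLittleO_univ (x₀ := 0) (n := 2) hφ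
  refine (ht.congr (fun t => ?_) (fun t => by simp))
  rw [taylorWithinEval_succ, taylorWithinEval_succ, taylor_within_zero_eval]
  simp only [iteratedDerivWithin_univ, iteratedDeriv_succ, iteratedDeriv_zero, hd1', hd2.deriv]
  simp
  ring

lemma aux_main (n k : ℕ) (hkn : k ≤ n) (w u : (Fin n → ℝ) → ℝ)
    (A : (Fin n → ℝ) → Matrix (Fin n) (Fin n) ℝ) (hA : ∀ x, (A x).IsHermitian)
    (hw : ContDiff ℝ (⊤ : ℕ∞) w)
    (x : Fin n → ℝ) (hadm : ∃ h : (confMat n A w x).IsHermitian,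
      h.eigenvalues ∈ closure (GammaCone n k))
    (hle : ∀ y, w y ≤ u y) (hx : w x = u x)
    (du : Fin n → ℝ) (H : Matrix (Fin n) (Fin n) ℝ) (hHsym : H.IsHermitian)
    (hTaylor : (fun h : Fin n → ℝ => u (x + h) - u x - (∑ i, du i * h i)
          - (1 / 2) * ∑ i, ∑ j, H i j * h i * h j) =o[𝓝 0] fun h => ‖h‖ ^ 2) :
    ∃ hU : (Matrix.of fun i j => H i j
        - (∑ l, (du l) ^ 2) / (2 * u x) * (if i = j then 1 else 0)
        + u x * A x i j : Matrix (Fin n) (Fin n) ℝ).IsHermitian,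
      hU.eigenvalues ∈ closure (GammaCone n k) := by
  have key : ∀ v : Fin n → ℝ, (∑ i, du i * v i) - (∑ i, fderiv ℝ w x (Pi.single i 1) * v i) = 0 ∧
      0 ≤ (1 / 2) * ((∑ i, ∑ j, H i j * v i * v j) - ∑ i, ∑ j, hessPi n w x i j * v i * v j) := by
    intro v
    have h1 := aux_taylor w hw x v
    have hl : Tendsto (fun t : ℝ => t • v) (𝓝 0) (𝓝 0) := by
      have : Continuous (fun t : ℝ => t • v) := by fun_prop
      simpa using this.tendsto 0
    have h2 := hTaylor.comp_tendsto hl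
    have h3 : ((fun h : Fin n → ℝ => ‖h‖ ^ 2) ∘ fun t : ℝ => t • v) =O[𝓝 0] fun t : ℝ => t ^ 2 := by
      refine IsBigO.of_bound (‖v‖ ^ 2) (Eventually.of_forall fun t => ?_)
      simp [norm_smul, mul_pow, mul_comm]
    have h4 := (h2.trans_isBigO h3).sub h1
    refine aux_quad _ _ _ h4 fun t => ?_
    have e1 : ∑ i, du i * (t • v) i = t * ∑ i, du i * v i := by
      rw [Finset.mul_sum]
      exact Finset.sum_congr rfl fun i _ => by simp; ring
    have e2 : ∑ i, ∑ j, H i j * (t • v) i * (t • v) j = t ^ 2 * ∑ i, ∑ j, H i j * v i * v j := by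
      rw [Finset.mul_sum]
      refine Finset.sum_congr rfl fun i _ => ?_
      rw [Finset.mul_sum]
      exact Finset.sum_congr rfl fun i _ => by simp; ring
    simp only [Function.comp_apply]
    rw [e1, e2, hx]
    have := hle (x + t • v)
    ring_nf
    ring_nf at this
    linarith
  have hdu : ∀ l, fderiv ℝ w x (Pi.single l 1) = du l := by
    intro l
    have := (key (Pi.single l 1)).1
    simp only [Pi.single_apply, mul_ite, mul_one, mul_zero, Finset.sum_ite_eq',
      Finset.mem_univ, if_true] at this
    linarith
  have hU : (Matrix.of fun i j => H i j
        - (∑ l, (du l) ^ 2) / (2 * u x) * (if i = j then 1 else 0)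
        + u x * A x i j : Matrix (Fin n) (Fin n) ℝ).IsHermitian := by
    ext i j
    have a1 := hHsym.apply i j
    have a2 := (hA x).apply i j
    simp only [star_trivial] at a1 a2
    simp [Matrix.conjTranspose_apply, a1, a2, eq_comm]
  obtain ⟨hW, hWe⟩ := hadm
  refine ⟨hU, aux_monotone hkn hW hU ?_ hWe⟩
  refine .of_dotProduct_mulVec_nonneg (hU.sub hW) fun v => ?_
  have hv := (key v).2
  have e : star v ⬝ᵥ ((Matrix.of fun i j => H i j
        - (∑ l, (du l) ^ 2) / (2 * u x) * (if i = j then 1 else 0)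
        + u x * A x i j : Matrix (Fin n) (Fin n) ℝ) - confMat n A w x).mulVec v =
      (∑ i, ∑ j, H i j * v i * v j) - ∑ i, ∑ j, hessPi n w x i j * v i * v j := by
    rw [← Finset.sum_sub_distrib]
    simp only [dotProduct, Matrix.mulVec, Finset.mul_sum]
    refine Finset.sum_congr rfl fun i _ => ?_
    rw [← Finset.sum_sub_distrib]
    refine Finset.sum_congr rfl fun j _ => ?_
    simp only [Matrix.sub_apply, Matrix.of_apply, confMat, hdu, hx, star_trivial]
    ring
  rw [e]
  linarith

/-- The maximum of two `k`-admissible functions is `k`-admissible at every point of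
twice differentiability: with `u = max(u₁,u₂)`, gradient `du` and Hessian `H` at `x`
(in the sense of a second-order Taylor expansion), the matrix
`H - (|du|²/(2u)) I + u A` has eigenvalues in `Γ̄_k`. -/
theorem stmt9 (n k : ℕ) (hn : 1 ≤ n) (hk : 1 ≤ k) (hkn : k ≤ n)
    (u₁ u₂ : (Fin n → ℝ) → ℝ)
    (A : (Fin n → ℝ) → Matrix (Fin n) (Fin n) ℝ)
    (hA : ∀ x, (A x).IsHermitian)
    (hu₁ : ContDiff ℝ (⊤ : ℕ∞) u₁) (hu₂ : ContDiff ℝ (⊤ : ℕ∞) u₂)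
    (hpos₁ : ∀ x, 0 < u₁ x) (hpos₂ : ∀ x, 0 < u₂ x)
    (hadm₁ : ∀ x, ∃ h : (confMat n A u₁ x).IsHermitian,
      h.eigenvalues ∈ closure (GammaCone n k))
    (hadm₂ : ∀ x, ∃ h : (confMat n A u₂ x).IsHermitian,
      h.eigenvalues ∈ closure (GammaCone n k))
    (x : Fin n → ℝ) (du : Fin n → ℝ) (H : Matrix (Fin n) (Fin n) ℝ)
    (hHsym : H.IsHermitian)
    (hTaylor : (fun h : Fin n → ℝ =>
        max (u₁ (x + h)) (u₂ (x + h)) - max (u₁ x) (u₂ x)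
          - (∑ i, du i * h i)
          - (1 / 2) * ∑ i, ∑ j, H i j * h i * h j) =o[𝓝 0] fun h => ‖h‖ ^ 2) :
    ∃ hU : (Matrix.of fun i j => H i j
        - (∑ l, (du l) ^ 2) / (2 * max (u₁ x) (u₂ x)) * (if i = j then 1 else 0)
        + max (u₁ x) (u₂ x) * A x i j : Matrix (Fin n) (Fin n) ℝ).IsHermitian,
      hU.eigenvalues ∈ closure (GammaCone n k) := by
  rcases le_total (u₂ x) (u₁ x) with h | h
  · exact aux_main n k hkn u₁ (fun y => max (u₁ y) (u₂ y)) A hA hu₁ x (hadm₁ x)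
      (fun y => le_max_left _ _) (max_eq_left h).symm du H hHsym hTaylor
  · exact aux_main n k hkn u₂ (fun y => max (u₁ y) (u₂ y)) A hA hu₂ x (hadm₂ x)
      (fun y => le_max_right _ _) (max_eq_right h).symm du H hHsym hTaylor
end
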